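/- arXiv:1511.01965 — 3 statements merged into one kernel-verified Lean document; each statement's English description precedes it below -/
import Mathlib

section
/- Let X ≥ 1, let π be a probability vector on {1,…,X}, let c ∈ ℝ^X, and let α ∈ (0,1]. If z₀ ∈ ℝ satisfies Σ_{i : c(i) > z₀} π(i) = α, then z₀ is a global minimizer of h_{π,c,α}; that is, h_{π,c,α}(z₀) ≤ h_{π,c,α}(z) for all z ∈ ℝ. -/
open Finset

/-- `hfun π c α z = z + (1/α) · ∑ i, π i · max (c i − z) 0`. -/
noncomputable def hfun {X : ℕ} (π c : Fin X → ℝ) (α z : ℝ) : ℝ :=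
  z + (1 / α) * ∑ i, π i * max (c i - z) 0

/-- If the tail probability `∑_{i : c i > z₀} π i` equals `α`, then `z₀` is a global
minimizer of the CVaR objective `hfun`. -/
theorem cvar_minimizer_of_tail_eq (X : ℕ) (hX : 1 ≤ X) (π c : Fin X → ℝ)
    (hπ0 : ∀ i, 0 ≤ π i) (hπ1 : ∑ i, π i = 1)
    (α : ℝ) (hα : α ∈ Set.Ioc (0 : ℝ) 1)
    (z₀ : ℝ) (htail : ∑ i ∈ univ.filter (fun i => z₀ < c i), π i = α) :
    ∀ z : ℝ, hfun π c α z₀ ≤ hfun π c α z := by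
  intro z
  have hα0 : 0 < α := hα.1
  have key : ∑ i, π i * max (c i - z₀) 0 ≤ ∑ i, π i * max (c i - z) 0 + (z - z₀) * α := by
    rw [← htail, sum_filter, mul_sum, ← sum_add_distrib]
    refine sum_le_sum fun i _ => ?_
    split_ifs with h
    · rw [max_eq_left (sub_nonneg.2 h.le)]
      nlinarith [mul_le_mul_of_nonneg_left (le_max_left (c i - z) 0) (hπ0 i)]
    · rw [max_eq_right (sub_nonpos.2 (not_lt.1 h))]
      simpa using mul_nonneg (hπ0 i) (le_max_right (c i - z) 0)
  have hscaled := mul_le_mul_of_nonneg_left key (one_div_pos.2 hα0).le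
  have hcancel : 1 / α * ((z - z₀) * α) = z - z₀ := by field_simp
  rw [mul_add, hcancel] at hscaled
  unfold hfun
  linarith
end

section
/- Let X ≥ 1, let π₁, π₂ be probability vectors on {1,…,X} with π₂ ≥_s π₁, let c₁ ∈ ℝ^X be nondecreasing, let c₂ ∈ ℝ^X be nonincreasing, and let α ∈ (0,1] satisfy α ≥ 1 − π₁(X). Then the single crossing condition holds: if CVaR_α(c₁;π₁) − CVaR_α(c₂;π₁) ≥ 0, then CVaR_α(c₁;π₂) − CVaR_α(c₂;π₂) ≥ 0. -/
open Finset

/-- `CVaR_α(c; π) = inf_z hfun π c α z`. -/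
noncomputable def CVaR {X : ℕ} (π c : Fin X → ℝ) (α : ℝ) : ℝ :=
  ⨅ z : ℝ, hfun π c α z

/-- Summation by parts: a function with nonnegative tail sums pairs nonnegatively with every
nonnegative monotone function. -/
theorem sum_mul_nonneg_of_tail_nonneg {n : ℕ} (d f : Fin n → ℝ)
    (hd : ∀ j, 0 ≤ ∑ i ∈ Ici j, d i) (hf : Monotone f) (hf0 : ∀ i, 0 ≤ f i) :
    0 ≤ ∑ i, d i * f i := by
  induction n with
  | zero => simp
  | succ n ih =>
    have htail := ih (fun i => d i.succ) (fun i => f i.succ - f 0)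
      (fun j => by
        have h := hd j.succ
        rw [← Fin.map_succEmb_Ici, sum_map] at h
        exact h)
      (fun i j hij => sub_le_sub_right (hf (Fin.succ_le_succ_iff.2 hij)) _)
      (fun i => sub_nonneg.2 (hf (Fin.zero_le _)))
    have htotal : 0 ≤ ∑ i, d i := by
      have huniv : (Ici 0 : Finset (Fin (n + 1))) = univ := by ext i; simp
      simpa only [huniv] using hd 0
    have hmul := mul_nonneg htotal (hf0 0)
    rw [Fin.sum_univ_succ] at hmul ⊢
    simp only [mul_sub, sum_sub_distrib, ← sum_mul] at htail
    linarith

/-- Expectations of monotone functions increase under first-order stochastic dominance. -/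
theorem sum_mul_le_of_dominated {n : ℕ} {p q f : Fin n → ℝ} (hpq : ∑ i, p i = ∑ i, q i)
    (hdom : ∀ j, ∑ i ∈ Ici j, p i ≤ ∑ i ∈ Ici j, q i) (hf : Monotone f) :
    ∑ i, p i * f i ≤ ∑ i, q i * f i := by
  cases n with
  | zero => simp
  | succ n =>
    have h := sum_mul_nonneg_of_tail_nonneg (fun i => q i - p i) (fun i => f i - f 0)
      (fun j => by simpa only [sum_sub_distrib, sub_nonneg] using hdom j)
      (fun i j hij => sub_le_sub_right (hf hij) _)
      (fun i => sub_nonneg.2 (hf (Fin.zero_le _)))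
    simp only [mul_sub, sub_mul, sum_sub_distrib, ← sum_mul, hpq] at h
    linarith

/-- The objective defining `CVaR` is bounded below by the expected cost. -/
theorem bddBelow_range_hfun {X : ℕ} {π : Fin X → ℝ} (c : Fin X → ℝ) {α : ℝ}
    (hπ0 : ∀ i, 0 ≤ π i) (hπ1 : ∑ i, π i = 1) (hα : α ∈ Set.Ioc (0 : ℝ) 1) :
    BddBelow (Set.range (hfun π c α)) := by
  refine ⟨∑ i, π i * c i, ?_⟩
  rintro _ ⟨z, rfl⟩
  have hexcess : ∑ i, π i * (c i - z) ≤ ∑ i, π i * max (c i - z) 0 :=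
    sum_le_sum fun i _ => mul_le_mul_of_nonneg_left (le_max_left _ _) (hπ0 i)
  have hnonneg : 0 ≤ ∑ i, π i * max (c i - z) 0 :=
    sum_nonneg fun i _ => mul_nonneg (hπ0 i) (le_max_right _ _)
  have hscale := le_mul_of_one_le_left hnonneg (one_le_one_div hα.1 hα.2)
  simp only [mul_sub, sum_sub_distrib, ← sum_mul, hπ1] at hexcess
  unfold hfun
  linarith

/-- `CVaR` is monotone in the distribution as soon as all expected excesses are. -/
theorem CVaR_le_CVaR {X : ℕ} {p q c : Fin X → ℝ} {α : ℝ}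
    (hp0 : ∀ i, 0 ≤ p i) (hp1 : ∑ i, p i = 1) (hα : α ∈ Set.Ioc (0 : ℝ) 1)
    (hexcess : ∀ z, ∑ i, p i * max (c i - z) 0 ≤ ∑ i, q i * max (c i - z) 0) :
    CVaR p c α ≤ CVaR q c α :=
  ciInf_mono (bddBelow_range_hfun c hp0 hp1 hα) fun z =>
    add_le_add_right (mul_le_mul_of_nonneg_left (hexcess z) (one_div_nonneg.2 hα.1.le)) z

/-- Single crossing condition: with `π₂ ≥_s π₁`, `c₁` nondecreasing, `c₂` nonincreasing
and `α ≥ 1 − π₁(X)`, if `CVaR_α(c₁;π₁) − CVaR_α(c₂;π₁) ≥ 0` then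
`CVaR_α(c₁;π₂) − CVaR_α(c₂;π₂) ≥ 0`. -/
theorem cvar_single_crossing (X : ℕ) (hX : 1 ≤ X) (π₁ π₂ : Fin X → ℝ)
    (h₁0 : ∀ i, 0 ≤ π₁ i) (h₁1 : ∑ i, π₁ i = 1)
    (h₂0 : ∀ i, 0 ≤ π₂ i) (h₂1 : ∑ i, π₂ i = 1)
    (hdom : ∀ j : Fin X, ∑ i ∈ Ici j, π₁ i ≤ ∑ i ∈ Ici j, π₂ i)
    (c₁ c₂ : Fin X → ℝ) (hc₁ : Monotone c₁) (hc₂ : Antitone c₂)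
    (α : ℝ) (hα : α ∈ Set.Ioc (0 : ℝ) 1)
    (hαbig : 1 - π₁ ⟨X - 1, by omega⟩ ≤ α)
    (hcross : 0 ≤ CVaR π₁ c₁ α - CVaR π₁ c₂ α) :
    0 ≤ CVaR π₂ c₁ α - CVaR π₂ c₂ α := by
  have hle₁ : CVaR π₁ c₁ α ≤ CVaR π₂ c₁ α := CVaR_le_CVaR h₁0 h₁1 hα fun z =>
    sum_mul_le_of_dominated (h₁1.trans h₂1.symm) hdom
      fun i j hij => max_le_max (sub_le_sub_right (hc₁ hij) z) le_rfl
  have hle₂ : CVaR π₂ c₂ α ≤ CVaR π₁ c₂ α := CVaR_le_CVaR h₂0 h₂1 hα fun z => by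
    have h := sum_mul_le_of_dominated (f := fun i => -max (c₂ i - z) 0)
      (h₁1.trans h₂1.symm) hdom
      fun i j hij => neg_le_neg (max_le_max (sub_le_sub_right (hc₂ hij) z) le_rfl)
    simpa only [mul_neg, sum_neg_distrib, neg_le_neg_iff] using h
  linarith
end

section
/- Let X ≥ 1 and let P be an X×X row-stochastic matrix (nonnegative entries, each row summing to 1) that is TP2. If π, π̄ are probability vectors on {1,…,X} with π̄ ≥_r π, then P'π̄ ≥_r P'π, where (P'π)(i) = Σ_{j=1}^X P(j,i)·π(j). -/
open Finset

/-- Symmetrized two-function Cauchy-Binet identity. -/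
theorem two_mul_sum_mul_sum_sub {ι R : Type*} [Fintype ι] [CommRing R] (a b p q : ι → R) :
    2 * ((∑ m, a m * p m) * (∑ m, b m * q m) - (∑ m, a m * q m) * (∑ m, b m * p m)) =
      ∑ m, ∑ n, (a m * b n - a n * b m) * (p m * q n - q m * p n) := by
  have h : (∑ m, a m * p m) * (∑ m, b m * q m) - (∑ m, a m * q m) * (∑ m, b m * p m) =
      ∑ m, ∑ n, a m * b n * (p m * q n - q m * p n) := by
    simp only [Finset.sum_mul_sum, ← Finset.sum_sub_distrib]
    exact Finset.sum_congr rfl fun m _ => Finset.sum_congr rfl fun n _ => by ring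
  have h' := h
  rw [Finset.sum_comm] at h'
  rw [two_mul]
  nth_rewrite 2 [h']
  rw [h]
  simp only [← Finset.sum_add_distrib]
  exact Finset.sum_congr rfl fun m _ => Finset.sum_congr rfl fun n _ => by ring

/-- A TP2 row-stochastic transition matrix preserves MLR dominance of beliefs under
prediction: `π̄ ≥_r π` implies `P'π̄ ≥_r P'π`, where `(P'π)(i) = ∑ j, P j i · π j`. -/
theorem predictor_preserves_mlr (X : ℕ) (hX : 1 ≤ X)
    (P : Fin X → Fin X → ℝ)
    (hP0 : ∀ i j, 0 ≤ P i j) (hProw : ∀ i, ∑ j, P i j = 1)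
    (hTP2 : ∀ (i i' j j' : Fin X), i ≤ i' → j ≤ j' →
      P i j' * P i' j ≤ P i j * P i' j')
    (π πb : Fin X → ℝ)
    (hπ0 : ∀ i, 0 ≤ π i) (hπ1 : ∑ i, π i = 1)
    (hπb0 : ∀ i, 0 ≤ πb i) (hπb1 : ∑ i, πb i = 1)
    (hmlr : ∀ i j : Fin X, i < j → πb i * π j ≤ π i * πb j) :
    ∀ i j : Fin X, i < j →
      (∑ m, P m i * πb m) * (∑ m, P m j * π m) ≤
        (∑ m, P m i * π m) * (∑ m, P m j * πb m) := by
  intro i j hij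
  have key := two_mul_sum_mul_sum_sub (fun m => P m i) (fun m => P m j) π πb
  have hnonneg : 0 ≤ ∑ m, ∑ n, (P m i * P n j - P n i * P m j) * (π m * πb n - πb m * π n) := by
    refine Finset.sum_nonneg fun m _ => Finset.sum_nonneg fun n _ => ?_
    rcases lt_trichotomy m n with h | rfl | h
    · have h₁ := hTP2 m n i j h.le hij.le
      have h₂ := hmlr m n h
      exact mul_nonneg (by linarith) (by linarith)
    · simp
    · have h₁ := hTP2 n m i j h.le hij.le
      have h₂ := hmlr n m h
      exact mul_nonneg_of_nonpos_of_nonpos (by linarith) (by linarith)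
  linarith
end
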